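/- arXiv:2110.08923 — 2 statements merged into one kernel-verified Lean document; each statement's English description precedes it below -/
import Mathlib

section
/- For all policies π and π′, the performance difference identity holds: V^{π′}(ρ) − V^π(ρ) = (1/(1−γ))·Σ_{s∈S} d_ρ^π(s)·Σ_{a∈A} (π′(a|s) − π(a|s))·Q^{π′}(s,a). -/
open scoped BigOperators

section CMDP

variable {S A : Type} [Fintype S] [Fintype A]

/-- `P` is a transition kernel: each `P s a` is a probability distribution over states. -/
def IsKernel (P : S → A → S → ℝ) : Prop :=
  (∀ s a s', 0 ≤ P s a s') ∧ ∀ s a, ∑ s', P s a s' = 1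

/-- `ρ` is a probability distribution over states. -/
def IsDist (ρ : S → ℝ) : Prop := (∀ s, 0 ≤ ρ s) ∧ ∑ s, ρ s = 1

/-- `π` is a (stationary, stochastic) policy. -/
def IsPolicy (π : S → A → ℝ) : Prop := (∀ s a, 0 ≤ π s a) ∧ ∀ s, ∑ a, π s a = 1

/-- One step of the state-action distribution dynamics under kernel `P` and policy `π`. -/
noncomputable def stepDist (P : S → A → S → ℝ) (π : S → A → ℝ) (μ : S → A → ℝ) :
    S → A → ℝ :=
  fun s a => (∑ s', ∑ a', μ s' a' * P s' a' s) * π s a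

/-- State-action distribution at time `t` of the Markov chain induced by `π`,
with initial state-action distribution `μ₀`. -/
noncomputable def trajSA (P : S → A → S → ℝ) (π : S → A → ℝ) (μ₀ : S → A → ℝ) :
    ℕ → S → A → ℝ
  | 0 => μ₀
  | (t + 1) => stepDist P π (trajSA P π μ₀ t)

/-- Initial state-action distribution when `s₀ ∼ ρ`, `a₀ ∼ π(·|s₀)`. -/
noncomputable def initSA (ρ : S → ℝ) (π : S → A → ℝ) : S → A → ℝ := fun s a => ρ s * π s a

/-- Initial state-action distribution that is a Dirac at `(s₀, a₀)`. -/
noncomputable def diracSA [DecidableEq S] [DecidableEq A] (s₀ : S) (a₀ : A) : S → A → ℝ :=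
  fun s a => if s = s₀ ∧ a = a₀ then 1 else 0

/-- Expected discounted cumulative value `E[∑ γ^t c(s_t,a_t)]` with initial
state-action distribution `μ₀`. -/
noncomputable def dsum (γ : ℝ) (P : S → A → S → ℝ) (π : S → A → ℝ) (μ₀ : S → A → ℝ)
    (c : S → A → ℝ) : ℝ :=
  ∑' t : ℕ, γ ^ t * ∑ s, ∑ a, trajSA P π μ₀ t s a * c s a

/-- Value function `V^π(ρ)` (for reward/utility `c`). -/
noncomputable def Vval (γ : ℝ) (P : S → A → S → ℝ) (π : S → A → ℝ) (ρ : S → ℝ)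
    (c : S → A → ℝ) : ℝ := dsum γ P π (initSA ρ π) c

/-- Q-function `Q^π(s,a)` (for reward/utility `c`). -/
noncomputable def Qval [DecidableEq S] [DecidableEq A] (γ : ℝ) (P : S → A → S → ℝ)
    (π : S → A → ℝ) (s : S) (a : A) (c : S → A → ℝ) : ℝ :=
  dsum γ P π (diracSA s a) c

/-- Discounted state visitation distribution `d_ρ^π(s)`. -/
noncomputable def visit (γ : ℝ) (P : S → A → S → ℝ) (π : S → A → ℝ) (ρ : S → ℝ)
    (s : S) : ℝ :=
  (1 - γ) * ∑' t : ℕ, γ ^ t * ∑ a, trajSA P π (initSA ρ π) t s a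

/-- Discounted entropy `H(ρ, π)`. -/
noncomputable def Hent (γ : ℝ) (P : S → A → S → ℝ) (π : S → A → ℝ) (ρ : S → ℝ) : ℝ :=
  Vval γ P π ρ (fun s a => -Real.log (π s a))

/-- Entropy-regularized value function `V_τ^π(ρ)`. -/
noncomputable def Vtau (γ τ : ℝ) (P : S → A → S → ℝ) (π : S → A → ℝ) (ρ : S → ℝ)
    (c : S → A → ℝ) : ℝ := Vval γ P π ρ c + τ * Hent γ P π ρ

/-- Euclidean norm of a vector indexed by state-action pairs. -/
noncomputable def polNorm2 (x : S → A → ℝ) : ℝ := Real.sqrt (∑ s, ∑ a, (x s a) ^ 2)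

/-- Euclidean norm of a vector in `ℝ^n`. -/
noncomputable def vecNorm2 {n : ℕ} (x : Fin n → ℝ) : ℝ := Real.sqrt (∑ i, (x i) ^ 2)

/-- The soft-max policy associated with parameter `θ`. -/
noncomputable def softmaxPol (θ : S → A → ℝ) : S → A → ℝ :=
  fun s a => Real.exp (θ s a) / ∑ a', Real.exp (θ s a')

/-- Membership in the soft-max policy class `Π`. -/
def InSoftmax (π : S → A → ℝ) : Prop := ∃ θ : S → A → ℝ, π = softmaxPol θ

/-- Lagrangian `L(π, λ)` of the entropy-regularized CMDP. -/
noncomputable def Lag (γ τ : ℝ) (P : S → A → S → ℝ) (ρ : S → ℝ) (r : S → A → ℝ)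
    {n : ℕ} (g : Fin n → S → A → ℝ) (b : Fin n → ℝ) (π : S → A → ℝ)
    (lam : Fin n → ℝ) : ℝ :=
  Vtau γ τ P π ρ r + ∑ i, lam i * (Vval γ P π ρ (g i) - b i)

/-- Dual function `D(λ) = max_{π ∈ Π} L(π, λ)`. -/
noncomputable def Dual (γ τ : ℝ) (P : S → A → S → ℝ) (ρ : S → ℝ) (r : S → A → ℝ)
    {n : ℕ} (g : Fin n → S → A → ℝ) (b : Fin n → ℝ) (lam : Fin n → ℝ) : ℝ :=
  sSup ((fun π : S → A → ℝ => Lag γ τ P ρ r g b π lam) '' {π | InSoftmax π})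

end CMDP

section Helpers

variable {S A : Type} [Fintype S] [Fintype A]

theorem sum_abs_stepDist_le {P : S → A → S → ℝ} (hP : IsKernel P) {π : S → A → ℝ}
    (hπ : IsPolicy π) (μ : S → A → ℝ) :
    ∑ s, ∑ a, |stepDist P π μ s a| ≤ ∑ s, ∑ a, |μ s a| := by
  calc ∑ s, ∑ a, |stepDist P π μ s a|
      = ∑ s, |∑ s', ∑ a', μ s' a' * P s' a' s| := by
        refine Finset.sum_congr rfl fun s _ => ?_
        simp only [stepDist, abs_mul, abs_of_nonneg (hπ.1 _ _)]
        rw [← Finset.mul_sum, hπ.2, mul_one]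
    _ ≤ ∑ s, ∑ s', ∑ a', |μ s' a'| * P s' a' s := by
        refine Finset.sum_le_sum fun s _ => (Finset.abs_sum_le_sum_abs _ _).trans ?_
        refine Finset.sum_le_sum fun s' _ => (Finset.abs_sum_le_sum_abs _ _).trans ?_
        refine Finset.sum_le_sum fun a' _ => ?_
        rw [abs_mul, abs_of_nonneg (hP.1 _ _ _)]
    _ = ∑ s, ∑ a, |μ s a| := by
        rw [Finset.sum_comm]
        refine Finset.sum_congr rfl fun s' _ => ?_
        rw [Finset.sum_comm]
        refine Finset.sum_congr rfl fun a' _ => ?_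
        rw [← Finset.mul_sum, hP.2, mul_one]

theorem sum_abs_trajSA_le {P : S → A → S → ℝ} (hP : IsKernel P) {π : S → A → ℝ}
    (hπ : IsPolicy π) (μ : S → A → ℝ) (t : ℕ) :
    ∑ s, ∑ a, |trajSA P π μ t s a| ≤ ∑ s, ∑ a, |μ s a| := by
  induction t with
  | zero => exact le_rfl
  | succ t ih => exact (sum_abs_stepDist_le hP hπ _).trans ih

theorem abs_trajSA_le {P : S → A → S → ℝ} (hP : IsKernel P) {π : S → A → ℝ}
    (hπ : IsPolicy π) (μ : S → A → ℝ) (t : ℕ) (s : S) (a : A) :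
    |trajSA P π μ t s a| ≤ ∑ s, ∑ a, |μ s a| := by
  refine le_trans ?_ (sum_abs_trajSA_le hP hπ μ t)
  refine (Finset.single_le_sum (f := fun a => |trajSA P π μ t s a|)
    (fun _ _ => abs_nonneg _) (Finset.mem_univ a)).trans ?_
  exact Finset.single_le_sum (f := fun s => ∑ a, |trajSA P π μ t s a|)
    (fun _ _ => Finset.sum_nonneg fun _ _ => abs_nonneg _) (Finset.mem_univ s)

theorem summable_pow_mul_trajSA {P : S → A → S → ℝ} (hP : IsKernel P) {π : S → A → ℝ}
    (hπ : IsPolicy π) {γ : ℝ} (hγ : γ ∈ Set.Ico (0 : ℝ) 1) (μ : S → A → ℝ) (s : S) (a : A) :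
    Summable fun t : ℕ => γ ^ t * trajSA P π μ t s a := by
  refine Summable.of_norm_bounded
    ((summable_geometric_of_lt_one hγ.1 hγ.2).mul_right (∑ s, ∑ a, |μ s a|)) fun t => ?_
  rw [Real.norm_eq_abs, abs_mul, abs_of_nonneg (pow_nonneg hγ.1 t)]
  exact mul_le_mul_of_nonneg_left (abs_trajSA_le hP hπ μ t s a) (pow_nonneg hγ.1 t)

theorem summable_pow_mul_sum_trajSA {P : S → A → S → ℝ} (hP : IsKernel P) {π : S → A → ℝ}
    (hπ : IsPolicy π) {γ : ℝ} (hγ : γ ∈ Set.Ico (0 : ℝ) 1) (μ c : S → A → ℝ) :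
    Summable fun t : ℕ => γ ^ t * ∑ s, ∑ a, trajSA P π μ t s a * c s a := by
  simp only [Finset.mul_sum, ← mul_assoc]
  exact summable_sum fun s _ => summable_sum fun a _ =>
    (summable_pow_mul_trajSA hP hπ hγ μ s a).mul_right _

theorem trajSA_succ' (P : S → A → S → ℝ) (π μ : S → A → ℝ) (t : ℕ) :
    trajSA P π μ (t + 1) = trajSA P π (stepDist P π μ) t := by
  induction t with
  | zero => rfl
  | succ t ih => exact congrArg (stepDist P π) ih

theorem dsum_eq_add_dsum_stepDist {P : S → A → S → ℝ} (hP : IsKernel P) {π : S → A → ℝ}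
    (hπ : IsPolicy π) {γ : ℝ} (hγ : γ ∈ Set.Ico (0 : ℝ) 1) (μ c : S → A → ℝ) :
    dsum γ P π μ c = ∑ s, ∑ a, μ s a * c s a + γ * dsum γ P π (stepDist P π μ) c := by
  unfold dsum
  rw [(summable_pow_mul_sum_trajSA hP hπ hγ μ c).tsum_eq_zero_add, ← tsum_mul_left]
  simp only [trajSA_succ', pow_succ', mul_assoc, pow_zero, one_mul]
  rfl

theorem stepDist_sum_mul {ι : Type*} [Fintype ι] (P : S → A → S → ℝ) (π : S → A → ℝ)
    (w : ι → ℝ) (m : ι → S → A → ℝ) (s : S) (a : A) :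
    stepDist P π (fun s a => ∑ i, w i * m i s a) s a = ∑ i, w i * stepDist P π (m i) s a := by
  simp only [stepDist, Finset.sum_mul, Finset.mul_sum]
  simp only [mul_assoc]
  conv_rhs => rw [Finset.sum_comm]
  exact Finset.sum_congr rfl fun s' _ => Finset.sum_comm

theorem trajSA_eq_sum_diracSA [DecidableEq S] [DecidableEq A] (P : S → A → S → ℝ)
    (π μ : S → A → ℝ) (t : ℕ) :
    trajSA P π μ t =
      fun s a => ∑ x : S × A, μ x.1 x.2 * trajSA P π (diracSA x.1 x.2) t s a := by
  induction t with
  | zero =>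
    funext s a
    rw [Finset.sum_eq_single (s, a)]
    · simp [trajSA, diracSA]
    · rintro ⟨s', a'⟩ _ h
      simp only [trajSA, diracSA]
      rw [if_neg, mul_zero]
      rintro ⟨rfl, rfl⟩
      exact h rfl
    · simp
  | succ t ih =>
    funext s a
    rw [trajSA, ih, stepDist_sum_mul]
    rfl

theorem dsum_eq_sum_mul_Qval [DecidableEq S] [DecidableEq A] {P : S → A → S → ℝ}
    (hP : IsKernel P) {π : S → A → ℝ} (hπ : IsPolicy π) {γ : ℝ} (hγ : γ ∈ Set.Ico (0 : ℝ) 1)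
    (μ c : S → A → ℝ) :
    dsum γ P π μ c = ∑ s, ∑ a, μ s a * Qval γ P π s a c := by
  have h (t : ℕ) : γ ^ t * ∑ s, ∑ a, trajSA P π μ t s a * c s a =
      ∑ x : S × A, μ x.1 x.2 *
        (γ ^ t * ∑ s, ∑ a, trajSA P π (diracSA x.1 x.2) t s a * c s a) := by
    simp only [mul_left_comm _ (γ ^ t)]
    rw [← Finset.mul_sum, trajSA_eq_sum_diracSA P π μ t]
    congr 1
    simp only [Finset.sum_mul, Finset.mul_sum (s := (Finset.univ : Finset S)),
      Finset.mul_sum (s := (Finset.univ : Finset A)), mul_assoc]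
    conv_rhs => rw [Finset.sum_comm]
    exact Finset.sum_congr rfl fun s _ => Finset.sum_comm
  have hs (x : S × A) : HasSum (fun t : ℕ => μ x.1 x.2 *
      (γ ^ t * ∑ s, ∑ a, trajSA P π (diracSA x.1 x.2) t s a * c s a))
      (μ x.1 x.2 * Qval γ P π x.1 x.2 c) :=
    (summable_pow_mul_sum_trajSA hP hπ hγ (diracSA x.1 x.2) c).hasSum.mul_left _
  rw [dsum, tsum_congr h, (hasSum_sum fun x _ => hs x).tsum_eq, Fintype.sum_prod_type]

theorem trajSA_initSA_eq_marginal_mul (P : S → A → S → ℝ) {π : S → A → ℝ} (hπ : IsPolicy π)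
    (ρ : S → ℝ) (t : ℕ) (s : S) (a : A) :
    trajSA P π (initSA ρ π) t s a = (∑ a', trajSA P π (initSA ρ π) t s a') * π s a := by
  cases t <;> simp only [trajSA, initSA, stepDist] <;> rw [← Finset.mul_sum, hπ.2, mul_one]

theorem stepDist_eq_marginal_mul (P : S → A → S → ℝ) {π : S → A → ℝ} (hπ : IsPolicy π)
    (π' μ : S → A → ℝ) :
    stepDist P π' μ = fun s a => (∑ a', stepDist P π μ s a') * π' s a := by
  funext s a
  simp only [stepDist]
  rw [← Finset.mul_sum, hπ.2, mul_one]

end Helpers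

/-- performance difference lemma:
`V^{π′}(ρ) − V^π(ρ) = (1/(1−γ))·Σ_s d_ρ^π(s)·Σ_a (π′(a|s) − π(a|s))·Q^{π′}(s,a)`. -/
theorem performance_difference
    {S A : Type} [Fintype S] [Fintype A] [DecidableEq S] [DecidableEq A]
    (P : S → A → S → ℝ) (r : S → A → ℝ) (γ : ℝ) (ρ : S → ℝ)
    (hP : IsKernel P) (hr : ∀ s a, r s a ∈ Set.Icc (0 : ℝ) 1)
    (hγ : γ ∈ Set.Ico (0 : ℝ) 1) (hρ : IsDist ρ)
    (π π' : S → A → ℝ) (hπ : IsPolicy π) (hπ' : IsPolicy π') :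
    Vval γ P π' ρ r - Vval γ P π ρ r =
      (1 / (1 - γ)) * ∑ s, visit γ P π ρ s *
        ∑ a, (π' s a - π s a) * Qval γ P π' s a r := by
  set m := trajSA P π (initSA ρ π) with hm
  set Q : S → A → ℝ := fun s a => Qval γ P π' s a r with hQ
  set f : ℕ → ℝ := fun t => ∑ s, ∑ a, (∑ a', m t s a') * π' s a * Q s a with hf
  have hγ1 : 1 - γ ≠ 0 := (sub_pos.2 hγ.2).ne'
  have marginal_summable (s : S) : Summable fun t : ℕ => γ ^ t * ∑ a, m t s a := by
    simp only [Finset.mul_sum]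
    exact summable_sum fun a _ => summable_pow_mul_trajSA hP hπ hγ _ s a
  have f_summable : Summable fun t : ℕ => γ ^ t * f t := by
    refine (summable_sum (s := Finset.univ) fun s _ =>
      (marginal_summable s).mul_right (∑ a, π' s a * Q s a)).congr fun t => ?_
    simp only [hf, mul_assoc, ← Finset.mul_sum]
  have f_zero : f 0 = Vval γ P π' ρ r := by
    rw [Vval, dsum_eq_sum_mul_Qval hP hπ' hγ]
    simp only [hf, hm, trajSA, initSA, ← Finset.mul_sum, hπ.2, mul_one, hQ]
  have bellman (t : ℕ) :
      ∑ s, ∑ a, m t s a * Q s a = ∑ s, ∑ a, m t s a * r s a + γ * f (t + 1) := by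
    rw [← dsum_eq_sum_mul_Qval hP hπ' hγ, dsum_eq_add_dsum_stepDist hP hπ' hγ,
      dsum_eq_sum_mul_Qval hP hπ' hγ, stepDist_eq_marginal_mul P hπ]
    rfl
  have step (t : ℕ) :
      ∑ s, γ ^ t * (∑ a, m t s a) * ∑ a, (π' s a - π s a) * Q s a =
        γ ^ t * f t - γ ^ (t + 1) * f (t + 1) - γ ^ t * ∑ s, ∑ a, m t s a * r s a := by
    have h : ∑ s, (∑ a, m t s a) * ∑ a, (π' s a - π s a) * Q s a =
        f t - ∑ s, ∑ a, m t s a * Q s a := by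
      simp only [hf, ← Finset.sum_sub_distrib]
      refine Finset.sum_congr rfl fun s _ => ?_
      rw [Finset.mul_sum]
      refine Finset.sum_congr rfl fun a _ => ?_
      rw [hm, trajSA_initSA_eq_marginal_mul P hπ ρ t s a]
      ring
    simp only [mul_assoc, ← Finset.mul_sum]
    rw [h, bellman]
    ring
  calc Vval γ P π' ρ r - Vval γ P π ρ r
      = ∑' t : ℕ, (γ ^ t * f t - γ ^ (t + 1) * f (t + 1) -
          γ ^ t * ∑ s, ∑ a, m t s a * r s a) := by
        have f_tail := (summable_nat_add_iff 1).2 f_summable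
        rw [(f_summable.sub f_tail).tsum_sub (summable_pow_mul_sum_trajSA hP hπ hγ _ r),
          f_summable.tsum_sub f_tail, f_summable.tsum_eq_zero_add, add_sub_cancel_right,
          pow_zero, one_mul, f_zero]
        rfl
    _ = ∑ s, (∑' t : ℕ, γ ^ t * ∑ a, m t s a) * ∑ a, (π' s a - π s a) * Q s a := by
        simp only [← step, ← tsum_mul_right]
        exact Summable.tsum_finsetSum fun s _ => (marginal_summable s).mul_right _
    _ = _ := by
        rw [Finset.mul_sum]
        refine Finset.sum_congr rfl fun s _ => ?_
        rw [visit, mul_assoc (1 - γ), ← mul_assoc (1 / (1 - γ)), one_div_mul_cancel hγ1, one_mul]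
end

section
/- Under the exploration assumption, for every λ ≥ 0 and every policy π ∈ Π, the Lagrangian gap admits the quadratic lower bound L(π_λ, λ) − L(π, λ) ≥ (τ·d/(2·(1−γ)·ln 2))·‖π − π_λ‖₂². -/
open scoped BigOperators

section Divergence

/-- Padé-type lower bound for the entropy function `u ↦ u log u`. -/
lemma sub_one_sq_div_le_mul_log {u : ℝ} (hu : 0 < u) :
    3 * (u - 1) ^ 2 / (2 * (u + 2)) ≤ u * Real.log u - u + 1 := by
  set f : ℝ → ℝ := fun x => Real.log x - (x - 1) * (5 * x + 1) / (2 * x * (x + 2)) with hf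
  have hderiv : ∀ x : ℝ, 0 < x → HasDerivAt f ((x - 1) ^ 3 / (x ^ 2 * (x + 2) ^ 2)) x := by
    intro x hx
    have hnum : HasDerivAt (fun x : ℝ => (x - 1) * (5 * x + 1))
        (1 * (5 * x + 1) + (x - 1) * (5 * 1)) x :=
      ((hasDerivAt_id x).sub_const 1).mul (((hasDerivAt_id x).const_mul 5).add_const 1)
    have hden : HasDerivAt (fun x : ℝ => 2 * x * (x + 2)) (2 * 1 * (x + 2) + 2 * x * 1) x :=
      ((hasDerivAt_id x).const_mul 2).mul ((hasDerivAt_id x).add_const 2)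
    have hne : 2 * x * (x + 2) ≠ 0 := by positivity
    refine ((Real.hasDerivAt_log hx.ne').sub (hnum.div hden hne)).congr_deriv ?_
    field_simp
    ring
  have hone : f 1 = 0 := by simp [hf]
  have hnonneg : 0 ≤ f u := by
    rcases le_total 1 u with h | h
    · have hmono : MonotoneOn f (Set.Ici 1) := by
        refine monotoneOn_of_hasDerivWithinAt_nonneg (convex_Ici 1)
          (fun x hx => (hderiv x (by linarith [Set.mem_Ici.1 hx])).continuousAt.continuousWithinAt)
          (fun x hx => (hderiv x ?_).hasDerivWithinAt) (fun x hx => ?_)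
        · rw [interior_Ici] at hx
          linarith [Set.mem_Ioi.1 hx]
        · rw [interior_Ici] at hx
          have : 0 ≤ x - 1 := by linarith [Set.mem_Ioi.1 hx]
          positivity
      rw [← hone]
      exact hmono (Set.mem_Ici.2 le_rfl) h h
    · have hanti : AntitoneOn f (Set.Ioc 0 1) := by
        refine antitoneOn_of_hasDerivWithinAt_nonpos (convex_Ioc 0 1)
          (fun x hx => (hderiv x hx.1).continuousAt.continuousWithinAt)
          (fun x hx => (hderiv x (interior_subset hx).1).hasDerivWithinAt) (fun x hx => ?_)
        have hx1 : x - 1 ≤ 0 := by linarith [(interior_subset hx).2]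
        exact div_nonpos_of_nonpos_of_nonneg (Odd.pow_nonpos (by decide) hx1) (by positivity)
      rw [← hone]
      exact hanti ⟨hu, h⟩ ⟨one_pos, le_rfl⟩ h
  have hmul := mul_nonneg hu.le hnonneg
  have hid : u * f u = u * Real.log u - u + 1 - 3 * (u - 1) ^ 2 / (2 * (u + 2)) := by
    simp only [hf]
    field_simp
    ring
  linarith

lemma sub_sq_div_le_mul_log_sub {p q : ℝ} (hp : 0 < p) (hq : 0 < q) :
    3 / 2 * (|p - q| ^ 2 / (p + 2 * q)) ≤ p * (Real.log p - Real.log q) - p + q := by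
  have h := mul_le_mul_of_nonneg_left (sub_one_sq_div_le_mul_log (div_pos hp hq)) hq.le
  rw [Real.log_div hp.ne' hq.ne'] at h
  rw [sq_abs]
  calc _ = q * (3 * (p / q - 1) ^ 2 / (2 * (p / q + 2))) := by field_simp
    _ ≤ _ := h
    _ = _ := by
      rw [mul_add, mul_sub, ← mul_assoc, mul_div_cancel₀ _ hq.ne', mul_one]

variable {A : Type} [Fintype A]

/-- A vector with zero sum satisfies `2 ‖x‖₂² ≤ ‖x‖₁²`. -/
lemma two_mul_sum_sq_le_sum_abs_sq {x : A → ℝ} (hx : ∑ a, x a = 0) :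
    2 * ∑ a, x a ^ 2 ≤ (∑ a, |x a|) ^ 2 := by
  classical
  have hle : ∀ a, 2 * |x a| ≤ ∑ b, |x b| := by
    intro a
    have h1 := Finset.add_sum_erase Finset.univ x (Finset.mem_univ a)
    have h2 := Finset.add_sum_erase Finset.univ (fun b => |x b|) (Finset.mem_univ a)
    have h3 := Finset.abs_sum_le_sum_abs x (Finset.univ.erase a)
    have h4 : |x a| = |∑ b ∈ Finset.univ.erase a, x b| := by
      rw [show x a = -∑ b ∈ Finset.univ.erase a, x b by linarith, abs_neg]
    linarith
  rw [sq, Finset.sum_mul, Finset.mul_sum]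
  refine Finset.sum_le_sum fun a _ => ?_
  rw [← sq_abs]
  nlinarith [hle a, abs_nonneg (x a)]

/-- Pinsker-type inequality: the Kullback-Leibler divergence dominates the squared Euclidean
distance. -/
lemma sum_sub_sq_le_sum_mul_log_sub {p q : A → ℝ} (hp : ∀ a, 0 < p a) (hq : ∀ a, 0 < q a)
    (hp1 : ∑ a, p a = 1) (hq1 : ∑ a, q a = 1) :
    ∑ a, (p a - q a) ^ 2 ≤ ∑ a, p a * (Real.log (p a) - Real.log (q a)) := by
  have h1 : 2 * ∑ a, (p a - q a) ^ 2 ≤ (∑ a, |p a - q a|) ^ 2 :=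
    two_mul_sum_sq_le_sum_abs_sq (by rw [Finset.sum_sub_distrib, hp1, hq1, sub_self])
  have h2 := Finset.sq_sum_div_le_sum_sq_div Finset.univ (fun a => |p a - q a|)
    (g := fun a => p a + 2 * q a) (fun a _ => by linarith [hp a, hq a])
  rw [Finset.sum_add_distrib, ← Finset.mul_sum, hp1, hq1] at h2
  have h3 := Finset.sum_le_sum fun a (_ : a ∈ Finset.univ) =>
    sub_sq_div_le_mul_log_sub (hp a) (hq a)
  rw [← Finset.mul_sum, Finset.sum_add_distrib, Finset.sum_sub_distrib, hp1, hq1] at h3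
  linarith

end Divergence

section Softmax

variable {S A : Type} [Fintype A]

lemma softmaxPol_pos (θ : S → A → ℝ) (s : S) (a : A) : 0 < softmaxPol θ s a :=
  div_pos (Real.exp_pos _)
    (Finset.sum_pos (fun _ _ => Real.exp_pos _) ⟨a, Finset.mem_univ a⟩)

lemma InSoftmax.pos {π : S → A → ℝ} (h : InSoftmax π) (s : S) (a : A) : 0 < π s a := by
  obtain ⟨θ, rfl⟩ := h
  exact softmaxPol_pos θ s a

lemma InSoftmax.sum_eq_one [Nonempty A] {π : S → A → ℝ} (h : InSoftmax π) (s : S) :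
    ∑ a, π s a = 1 := by
  obtain ⟨θ, rfl⟩ := h
  simp only [softmaxPol]
  rw [← Finset.sum_div]
  exact div_self (Finset.sum_pos (fun _ _ => Real.exp_pos _) Finset.univ_nonempty).ne'

lemma InSoftmax.isPolicy [Nonempty A] {π : S → A → ℝ} (h : InSoftmax π) : IsPolicy π :=
  ⟨fun s a => (h.pos s a).le, h.sum_eq_one⟩

lemma sum_initSA {ρ : S → ℝ} {π : S → A → ℝ} (hπ : IsPolicy π) (s : S) :
    ∑ a, initSA ρ π s a = ρ s := by
  simp only [initSA]
  rw [← Finset.mul_sum, hπ.2 s, mul_one]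

end Softmax

section DiscountedSums

variable {S A : Type} [Fintype S] [Fintype A]

variable {P : S → A → S → ℝ} {π : S → A → ℝ} {ρ : S → ℝ} {γ : ℝ}

lemma trajSA_nonneg (hP : IsKernel P) (hπ : IsPolicy π) (hρ : IsDist ρ) (t : ℕ) (s : S) (a : A) :
    0 ≤ trajSA P π (initSA ρ π) t s a := by
  induction t generalizing s a with
  | zero => exact mul_nonneg (hρ.1 s) (hπ.1 s a)
  | succ t ih =>
    exact mul_nonneg (Finset.sum_nonneg fun s' _ => Finset.sum_nonneg fun a' _ =>
      mul_nonneg (ih s' a') (hP.1 s' a' s)) (hπ.1 s a)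

lemma sum_trajSA_succ (hπ : IsPolicy π) (μ : S → A → ℝ) (t : ℕ) (s : S) :
    ∑ a, trajSA P π μ (t + 1) s a = ∑ s', ∑ a', trajSA P π μ t s' a' * P s' a' s := by
  simp only [trajSA, stepDist]
  rw [← Finset.mul_sum, hπ.2 s, mul_one]

lemma trajSA_eq_sum_mul (hπ : IsPolicy π) (t : ℕ) (s : S) (a : A) :
    trajSA P π (initSA ρ π) t s a = (∑ a', trajSA P π (initSA ρ π) t s a') * π s a := by
  cases t with
  | zero => simp only [trajSA, sum_initSA hπ]; rfl
  | succ t => rw [sum_trajSA_succ hπ]; rfl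

/-- Pushing a function of the state through one transition. -/
lemma sum_trajSA_mul_transition (hπ : IsPolicy π) (μ : S → A → ℝ) (V : S → ℝ) (t : ℕ) :
    ∑ s, ∑ a, trajSA P π μ t s a * ∑ s', P s a s' * V s' =
      ∑ s, ∑ a, trajSA P π μ (t + 1) s a * V s := by
  simp_rw [← Finset.sum_mul, sum_trajSA_succ hπ, Finset.sum_mul, Finset.mul_sum]
  symm
  rw [Finset.sum_comm]
  refine Finset.sum_congr rfl fun s _ => ?_
  rw [Finset.sum_comm]
  simp_rw [mul_assoc]

lemma sum_trajSA (hP : IsKernel P) (hπ : IsPolicy π) (hρ : IsDist ρ) (t : ℕ) :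
    ∑ s, ∑ a, trajSA P π (initSA ρ π) t s a = 1 := by
  induction t with
  | zero => simp only [trajSA, sum_initSA hπ, hρ.2]
  | succ t ih =>
    have h := sum_trajSA_mul_transition (P := P) hπ (initSA ρ π) (fun _ => 1) t
    simp only [mul_one, hP.2] at h
    rw [← h, ih]

lemma trajSA_le_one (hP : IsKernel P) (hπ : IsPolicy π) (hρ : IsDist ρ) (t : ℕ) (s : S) (a : A) :
    trajSA P π (initSA ρ π) t s a ≤ 1 := by
  have hnn := trajSA_nonneg hP hπ hρ t
  calc trajSA P π (initSA ρ π) t s a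
      ≤ ∑ a', trajSA P π (initSA ρ π) t s a' :=
        Finset.single_le_sum (fun a' _ => hnn s a') (Finset.mem_univ a)
    _ ≤ ∑ s', ∑ a', trajSA P π (initSA ρ π) t s' a' :=
        Finset.single_le_sum (f := fun s' => ∑ a', trajSA P π (initSA ρ π) t s' a')
          (fun s' _ => Finset.sum_nonneg fun a' _ => hnn s' a') (Finset.mem_univ s)
    _ = 1 := sum_trajSA hP hπ hρ t

lemma summable_discounted_trajSA (hP : IsKernel P) (hπ : IsPolicy π) (hρ : IsDist ρ)
    (hγ : γ ∈ Set.Ico (0 : ℝ) 1) (s : S) (a : A) :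
    Summable fun t : ℕ => γ ^ t * trajSA P π (initSA ρ π) t s a :=
  Summable.of_nonneg_of_le
    (fun t => mul_nonneg (pow_nonneg hγ.1 t) (trajSA_nonneg hP hπ hρ t s a))
    (fun t => mul_le_of_le_one_right (pow_nonneg hγ.1 t) (trajSA_le_one hP hπ hρ t s a))
    (summable_geometric_of_lt_one hγ.1 hγ.2)

lemma summable_discounted_sum (hP : IsKernel P) (hπ : IsPolicy π) (hρ : IsDist ρ)
    (hγ : γ ∈ Set.Ico (0 : ℝ) 1) (c : S → A → ℝ) :
    Summable fun t : ℕ => γ ^ t * ∑ s, ∑ a, trajSA P π (initSA ρ π) t s a * c s a := by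
  simp_rw [Finset.mul_sum, ← mul_assoc]
  exact summable_sum fun s _ => summable_sum fun a _ =>
    (summable_discounted_trajSA hP hπ hρ hγ s a).mul_right (c s a)

/-- The discounted value as a finite sum against the occupation measure. -/
lemma Vval_eq_sum (hP : IsKernel P) (hπ : IsPolicy π) (hρ : IsDist ρ)
    (hγ : γ ∈ Set.Ico (0 : ℝ) 1) (c : S → A → ℝ) :
    Vval γ P π ρ c =
      ∑ s, ∑ a, (∑' t : ℕ, γ ^ t * trajSA P π (initSA ρ π) t s a) * c s a := by
  have hs := summable_discounted_trajSA hP hπ hρ hγ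
  simp only [Vval, dsum]
  simp_rw [Finset.mul_sum, ← mul_assoc]
  rw [Summable.tsum_finsetSum fun s _ => summable_sum fun a _ => (hs s a).mul_right (c s a)]
  refine Finset.sum_congr rfl fun s _ => ?_
  rw [Summable.tsum_finsetSum fun a _ => (hs s a).mul_right (c s a)]
  simp_rw [tsum_mul_right]

/-- The occupation measure factors through the state visitation distribution. -/
lemma tsum_trajSA_eq_visit (hπ : IsPolicy π) (hγ : γ ∈ Set.Ico (0 : ℝ) 1) (s : S) (a : A) :
    ∑' t : ℕ, γ ^ t * trajSA P π (initSA ρ π) t s a =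
      visit γ P π ρ s / (1 - γ) * π s a := by
  have h1 : 1 - γ ≠ 0 := by linarith [hγ.2]
  simp_rw [visit, mul_div_cancel_left₀ _ h1, ← tsum_mul_right, mul_assoc,
    ← trajSA_eq_sum_mul hπ]

lemma Vval_eq_sum_visit (hP : IsKernel P) (hπ : IsPolicy π) (hρ : IsDist ρ)
    (hγ : γ ∈ Set.Ico (0 : ℝ) 1) (c : S → A → ℝ) :
    Vval γ P π ρ c = ∑ s, visit γ P π ρ s / (1 - γ) * ∑ a, π s a * c s a := by
  rw [Vval_eq_sum hP hπ hρ hγ]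
  simp_rw [tsum_trajSA_eq_visit hπ hγ, Finset.mul_sum, mul_assoc]

/-- Telescoping of the discounted Bellman residual. -/
lemma Vval_bellman_residual (hP : IsKernel P) (hπ : IsPolicy π) (hρ : IsDist ρ)
    (hγ : γ ∈ Set.Ico (0 : ℝ) 1) (V : S → ℝ) :
    Vval γ P π ρ (fun s a => V s - γ * ∑ s', P s a s' * V s') = ∑ s, ρ s * V s := by
  set f : ℕ → ℝ := fun t => γ ^ t * ∑ s, ∑ a, trajSA P π (initSA ρ π) t s a * V s with hf
  have hsum : Summable f := summable_discounted_sum hP hπ hρ hγ fun s _ => V s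
  have hterm : ∀ t : ℕ, γ ^ t * ∑ s, ∑ a, trajSA P π (initSA ρ π) t s a *
      (V s - γ * ∑ s', P s a s' * V s') = f t - f (t + 1) := by
    intro t
    simp only [hf]
    rw [← sum_trajSA_mul_transition hπ, pow_succ, mul_assoc, ← mul_sub]
    congr 1
    simp_rw [Finset.mul_sum (a := γ), ← Finset.sum_sub_distrib]
    refine Finset.sum_congr rfl fun s _ => Finset.sum_congr rfl fun a _ => ?_
    rw [← Finset.mul_sum]
    ring
  have hshift : Summable fun t => f (t + 1) := (summable_nat_add_iff 1).2 hsum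
  have hzero : f 0 = ∑ s, ρ s * V s := by
    simp only [hf, trajSA, pow_zero, one_mul, ← Finset.sum_mul, sum_initSA hπ]
  simp only [Vval, dsum]
  simp_rw [hterm]
  rw [hsum.tsum_sub hshift, hsum.tsum_eq_zero_add, hzero]
  ring

end DiscountedSums

section SoftBellman

variable {S A : Type} [Fintype S] [Fintype A]

lemma log_sum_exp_le_add [Nonempty A] {τ k : ℝ} (hτ : 0 < τ) {x y : A → ℝ}
    (h : ∀ a, x a ≤ y a + k) :
    τ * Real.log (∑ a, Real.exp (x a / τ)) ≤ τ * Real.log (∑ a, Real.exp (y a / τ)) + k := by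
  have hx : 0 < ∑ a, Real.exp (x a / τ) :=
    Finset.sum_pos (fun _ _ => Real.exp_pos _) Finset.univ_nonempty
  have hy : 0 < ∑ a, Real.exp (y a / τ) :=
    Finset.sum_pos (fun _ _ => Real.exp_pos _) Finset.univ_nonempty
  have hle : ∑ a, Real.exp (x a / τ) ≤ (∑ a, Real.exp (y a / τ)) * Real.exp (k / τ) := by
    rw [Finset.sum_mul]
    refine Finset.sum_le_sum fun a _ => ?_
    rw [← Real.exp_add, ← add_div]
    exact Real.exp_le_exp.2 (div_le_div_of_nonneg_right (h a) hτ.le)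
  have hlog := Real.log_le_log hx hle
  rw [Real.log_mul hy.ne' (Real.exp_pos _).ne', Real.log_exp] at hlog
  calc _ ≤ τ * (Real.log (∑ a, Real.exp (y a / τ)) + k / τ) :=
        mul_le_mul_of_nonneg_left hlog hτ.le
    _ = _ := by rw [mul_add, mul_div_cancel₀ _ hτ.ne']

/-- Existence of a solution of the soft Bellman optimality equation. -/
lemma exists_soft_bellman_fixedPoint [Nonempty A] {P : S → A → S → ℝ} {γ τ : ℝ}
    (hP : IsKernel P) (hγ : γ ∈ Set.Ico (0 : ℝ) 1) (hτ : 0 < τ) (c : S → A → ℝ) :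
    ∃ V : S → ℝ, ∀ s,
      τ * Real.log (∑ a, Real.exp ((c s a + γ * ∑ s', P s a s' * V s') / τ)) = V s := by
  set T : (S → ℝ) → S → ℝ := fun V s =>
    τ * Real.log (∑ a, Real.exp ((c s a + γ * ∑ s', P s a s' * V s') / τ)) with hT
  have hle : ∀ V W : S → ℝ, ∀ s, T V s ≤ T W s + γ * dist V W := by
    intro V W s
    refine log_sum_exp_le_add hτ fun a => ?_
    have h : ∑ s', P s a s' * V s' ≤ ∑ s', P s a s' * W s' + dist V W := by
      calc ∑ s', P s a s' * V s' ≤ ∑ s', P s a s' * (W s' + dist V W) := by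
            refine Finset.sum_le_sum fun s' _ => mul_le_mul_of_nonneg_left ?_ (hP.1 s a s')
            have h1 := dist_le_pi_dist V W s'
            rw [Real.dist_eq] at h1
            linarith [le_abs_self (V s' - W s')]
        _ = _ := by
            simp_rw [mul_add, Finset.sum_add_distrib, ← Finset.sum_mul, hP.2, one_mul]
    nlinarith [mul_le_mul_of_nonneg_left h hγ.1]
  have hcontr : ContractingWith ⟨γ, hγ.1⟩ T := by
    refine ⟨by exact_mod_cast hγ.2, LipschitzWith.of_dist_le_mul fun V W => ?_⟩
    refine (dist_pi_le_iff (mul_nonneg hγ.1 dist_nonneg)).2 fun s => ?_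
    rw [Real.dist_eq, abs_sub_le_iff]
    have h1 := hle V W s
    have h2 := hle W V s
    rw [dist_comm W V] at h2
    constructor
    · change _ ≤ γ * dist V W
      linarith
    · change _ ≤ γ * dist V W
      linarith
  exact ⟨hcontr.fixedPoint, fun s => congrFun hcontr.fixedPoint_isFixedPt s⟩

/-- A soft-max policy that is greedy for its own soft value function. -/
lemma exists_soft_optimal_policy [Nonempty A] {P : S → A → S → ℝ} {γ τ : ℝ}
    (hP : IsKernel P) (hγ : γ ∈ Set.Ico (0 : ℝ) 1) (hτ : 0 < τ) (c : S → A → ℝ) :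
    ∃ (V : S → ℝ) (π : S → A → ℝ), InSoftmax π ∧ ∀ s a,
      τ * Real.log (π s a) = c s a + γ * ∑ s', P s a s' * V s' - V s := by
  obtain ⟨V, hV⟩ := exists_soft_bellman_fixedPoint hP hγ hτ c
  refine ⟨V, softmaxPol fun s a => (c s a + γ * ∑ s', P s a s' * V s') / τ, ⟨_, rfl⟩,
    fun s a => ?_⟩
  have hpos : 0 < ∑ a, Real.exp ((c s a + γ * ∑ s', P s a s' * V s') / τ) :=
    Finset.sum_pos (fun _ _ => Real.exp_pos _) Finset.univ_nonempty
  simp only [softmaxPol]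
  rw [Real.log_div (Real.exp_pos _).ne' hpos.ne', Real.log_exp, mul_sub, hV s,
    mul_div_cancel₀ _ hτ.ne']

end SoftBellman

section LagrangianGap

variable {S A : Type} [Fintype S] [Fintype A] {P : S → A → S → ℝ} {π : S → A → ℝ} {ρ : S → ℝ}
  {γ : ℝ}

lemma Vval_add (hP : IsKernel P) (hπ : IsPolicy π) (hρ : IsDist ρ)
    (hγ : γ ∈ Set.Ico (0 : ℝ) 1) (c c' : S → A → ℝ) :
    Vval γ P π ρ (fun s a => c s a + c' s a) = Vval γ P π ρ c + Vval γ P π ρ c' := by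
  simp_rw [Vval_eq_sum hP hπ hρ hγ, mul_add, Finset.sum_add_distrib]

lemma Vval_const_mul (hP : IsKernel P) (hπ : IsPolicy π) (hρ : IsDist ρ)
    (hγ : γ ∈ Set.Ico (0 : ℝ) 1) (k : ℝ) (c : S → A → ℝ) :
    Vval γ P π ρ (fun s a => k * c s a) = k * Vval γ P π ρ c := by
  simp_rw [Vval_eq_sum hP hπ hρ hγ, Finset.mul_sum]
  refine Finset.sum_congr rfl fun s _ => Finset.sum_congr rfl fun a _ => ?_
  ring

lemma Vval_sum (hP : IsKernel P) (hπ : IsPolicy π) (hρ : IsDist ρ)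
    (hγ : γ ∈ Set.Ico (0 : ℝ) 1) {ι : Type*} (I : Finset ι) (c : ι → S → A → ℝ) :
    Vval γ P π ρ (fun s a => ∑ i ∈ I, c i s a) = ∑ i ∈ I, Vval γ P π ρ (c i) := by
  simp_rw [Vval_eq_sum hP hπ hρ hγ, Finset.mul_sum]
  symm
  rw [Finset.sum_comm]
  exact Finset.sum_congr rfl fun s _ => Finset.sum_comm

/-- The Lagrangian is the value of a single regularized reward, up to a constant. -/
lemma Lag_eq_Vval (hP : IsKernel P) (hπ : IsPolicy π) (hρ : IsDist ρ)
    (hγ : γ ∈ Set.Ico (0 : ℝ) 1) (τ : ℝ) (r : S → A → ℝ) {n : ℕ} (g : Fin n → S → A → ℝ)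
    (b lam : Fin n → ℝ) :
    Lag γ τ P ρ r g b π lam =
      Vval γ P π ρ (fun s a => (r s a + ∑ i, lam i * g i s a) + τ * -Real.log (π s a)) -
        ∑ i, lam i * b i := by
  rw [Vval_add hP hπ hρ hγ, Vval_add hP hπ hρ hγ, Vval_const_mul hP hπ hρ hγ,
    Vval_sum hP hπ hρ hγ]
  simp_rw [Vval_const_mul hP hπ hρ hγ]
  simp only [Lag, Vtau, Hent, mul_sub, Finset.sum_sub_distrib]
  ring

/-- The Lagrangian of a policy, relative to a soft optimal policy `πs` with soft value `V`. -/
lemma Lag_eq_sub_divergence (hP : IsKernel P) (hπ : IsPolicy π) (hρ : IsDist ρ)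
    (hγ : γ ∈ Set.Ico (0 : ℝ) 1) {τ : ℝ} {r : S → A → ℝ} {n : ℕ} {g : Fin n → S → A → ℝ}
    (b : Fin n → ℝ) {lam : Fin n → ℝ} {V : S → ℝ} {πs : S → A → ℝ}
    (hs : ∀ s a, τ * Real.log (πs s a) =
      (r s a + ∑ i, lam i * g i s a) + γ * ∑ s', P s a s' * V s' - V s) :
    Lag γ τ P ρ r g b π lam = ∑ s, ρ s * V s - ∑ i, lam i * b i -
      τ * ∑ s, visit γ P π ρ s / (1 - γ) *
        ∑ a, π s a * (Real.log (π s a) - Real.log (πs s a)) := by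
  have hc : (fun s a => (r s a + ∑ i, lam i * g i s a) + τ * -Real.log (π s a)) =
      fun s a => (V s - γ * ∑ s', P s a s' * V s') +
        -τ * (Real.log (π s a) - Real.log (πs s a)) := by
    funext s a
    linarith [hs s a]
  rw [Lag_eq_Vval hP hπ hρ hγ, hc, Vval_add hP hπ hρ hγ, Vval_const_mul hP hπ hρ hγ,
    Vval_bellman_residual hP hπ hρ hγ, Vval_eq_sum_visit hP hπ hρ hγ]
  ring

/-- Quadratic growth of the Lagrangian gap around a soft optimal policy. -/
lemma Lag_add_quadratic_le [Nonempty A] (hP : IsKernel P) (hρ : IsDist ρ)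
    (hγ : γ ∈ Set.Ico (0 : ℝ) 1) {τ : ℝ} (hτ : 0 < τ) {r : S → A → ℝ} {n : ℕ}
    {g : Fin n → S → A → ℝ} (b : Fin n → ℝ) {lam : Fin n → ℝ} {V : S → ℝ} {πs : S → A → ℝ}
    (hπs : InSoftmax πs) (hπ : InSoftmax π)
    (hs : ∀ s a, τ * Real.log (πs s a) =
      (r s a + ∑ i, lam i * g i s a) + γ * ∑ s', P s a s' * V s' - V s)
    {d : ℝ} (hd : 0 < d) (hexp : ∀ s, d ≤ visit γ P π ρ s) :
    Lag γ τ P ρ r g b π lam + τ * (d / (1 - γ)) * ∑ s, ∑ a, (π s a - πs s a) ^ 2 ≤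
      Lag γ τ P ρ r g b πs lam := by
  have h1 : 0 < 1 - γ := by linarith [hγ.2]
  rw [Lag_eq_sub_divergence hP hπ.isPolicy hρ hγ b hs,
    Lag_eq_sub_divergence hP hπs.isPolicy hρ hγ b hs]
  have hle : d / (1 - γ) * ∑ s, ∑ a, (π s a - πs s a) ^ 2 ≤
      ∑ s, visit γ P π ρ s / (1 - γ) *
        ∑ a, π s a * (Real.log (π s a) - Real.log (πs s a)) := by
    rw [Finset.mul_sum]
    refine Finset.sum_le_sum fun s _ => ?_
    have hkl := sum_sub_sq_le_sum_mul_log_sub (hπ.pos s) (hπs.pos s) (hπ.sum_eq_one s)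
      (hπs.sum_eq_one s)
    exact mul_le_mul (div_le_div_of_nonneg_right (hexp s) h1.le) hkl
      (Finset.sum_nonneg fun a _ => sq_nonneg _) (div_nonneg (hd.le.trans (hexp s)) h1.le)
  have := mul_le_mul_of_nonneg_left hle hτ.le
  simp only [sub_self, mul_zero, Finset.sum_const_zero]
  linarith

end LagrangianGap

/-- Proposition 1, quadratic lower bound on the Lagrangian gap: under the
exploration assumption, for every `λ ≥ 0` and `π ∈ Π`,
`L(π_λ, λ) − L(π, λ) ≥ (τ·d/(2(1−γ)·ln 2))·‖π − π_λ‖₂²`. -/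
theorem lagrangian_quadratic_lower_bound
    {S A : Type} [Fintype S] [Fintype A]
    (P : S → A → S → ℝ) (r : S → A → ℝ) (γ τ : ℝ) (ρ : S → ℝ) {n : ℕ}
    (g : Fin n → S → A → ℝ) (b : Fin n → ℝ)
    (hP : IsKernel P) (hr : ∀ s a, r s a ∈ Set.Icc (0 : ℝ) 1)
    (hγ : γ ∈ Set.Ico (0 : ℝ) 1) (hρ : IsDist ρ) (hτ : 0 < τ)
    (hg : ∀ i s a, g i s a ∈ Set.Icc (0 : ℝ) 1)
    (hb : ∀ i, b i ∈ Set.Icc (0 : ℝ) (1 / (1 - γ)))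
    -- exploration assumption
    (d : ℝ) (hd : 0 < d)
    (hexp : ∀ π : S → A → ℝ, InSoftmax π → ∀ s, d ≤ visit γ P π ρ s)
    -- `π_λ` is a maximizer of `L(·, λ)` over `Π`
    (lam : Fin n → ℝ) (hlam : ∀ i, 0 ≤ lam i)
    (πlam : S → A → ℝ) (hlamIn : InSoftmax πlam)
    (hlamopt : ∀ π' : S → A → ℝ, InSoftmax π' →
      Lag γ τ P ρ r g b π' lam ≤ Lag γ τ P ρ r g b πlam lam)
    (π : S → A → ℝ) (hπ : InSoftmax π) :
    Lag γ τ P ρ r g b πlam lam - Lag γ τ P ρ r g b π lam ≥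
      (τ * d / (2 * (1 - γ) * Real.log 2)) *
        (polNorm2 (fun s a => π s a - πlam s a)) ^ 2 := by
  have hS : Nonempty S := by
    by_contra h
    rw [not_nonempty_iff] at h
    simpa using hρ.2
  have hA : Nonempty A := by
    by_contra h
    rw [not_nonempty_iff] at h
    have := hexp π hπ (Classical.choice hS)
    simp only [visit, Finset.univ_eq_empty, Finset.sum_empty, mul_zero, tsum_zero] at this
    linarith
  have h1 : 0 < 1 - γ := by linarith [hγ.2]
  obtain ⟨V, πs, hπs, hs⟩ :=
    exists_soft_optimal_policy hP hγ hτ fun s a => r s a + ∑ i, lam i * g i s a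
  have hk : 0 < τ * (d / (1 - γ)) := mul_pos hτ (div_pos hd h1)
  have heq : πlam = πs := by
    have hgap := Lag_add_quadratic_le hP hρ hγ hτ b hπs hlamIn hs hd (hexp πlam hlamIn)
    have hopt := hlamopt πs hπs
    have hnn : ∀ s, 0 ≤ ∑ a, (πlam s a - πs s a) ^ 2 :=
      fun s => Finset.sum_nonneg fun a _ => sq_nonneg _
    have hzero : ∑ s, ∑ a, (πlam s a - πs s a) ^ 2 = 0 :=
      le_antisymm (nonpos_of_mul_nonpos_right (by linarith) hk)
        (Finset.sum_nonneg fun s _ => hnn s)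
    funext s a
    have hzs := (Finset.sum_eq_zero_iff_of_nonneg fun s _ => hnn s).1 hzero s (Finset.mem_univ s)
    have hza := (Finset.sum_eq_zero_iff_of_nonneg fun a _ => sq_nonneg _).1 hzs a
      (Finset.mem_univ a)
    exact sub_eq_zero.1 (pow_eq_zero_iff two_ne_zero |>.1 hza)
  subst heq
  have hgap := Lag_add_quadratic_le hP hρ hγ hτ b hlamIn hπ hs hd (hexp π hπ)
  have hN : 0 ≤ ∑ s, ∑ a, (π s a - πlam s a) ^ 2 :=
    Finset.sum_nonneg fun s _ => Finset.sum_nonneg fun a _ => sq_nonneg _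
  have hlog : 1 ≤ 2 * Real.log 2 := by linarith [Real.log_two_gt_d9]
  have hconst : τ * d / (2 * (1 - γ) * Real.log 2) ≤ τ * (d / (1 - γ)) := by
    rw [← mul_div_assoc]
    refine div_le_div_of_nonneg_left (mul_pos hτ hd).le h1 ?_
    nlinarith
  rw [polNorm2, Real.sq_sqrt hN]
  linarith [mul_le_mul_of_nonneg_right hconst hN]
end
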